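/- For all real x ≥ 2, the difference between the sum of log p over prime powers p^r ≤ x and the Chebyshev function θ(x) = ∑_{p ≤ x} log p satisfies 0 ≤ ∑_{p^r ≤ x, r ≥ 2} log p ≤ 1.42620 √x. -/

import Mathlib

open Real

namespace PsiTheta

open Chebyshev

def stepG (n L : ℕ) : ℕ := (n + 1) / Nat.gcd L (n + 1)

def chkF : ℕ → ℕ → ℕ → ℕ → List ℕ → Bool
  | 0, _, _, _, _ => true
  | f + 1, n, L, G, ps =>
    cond (Nat.beq (stepG n L) 1 || Nat.beq (stepG n L) (n + 1))
      (chkF f (n + 1) (L * stepG n L) G ps)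
      ((Nat.ble (ps.headD 0 * ps.headD 0 * 10 ^ 8) (133 ^ 2 * 14262 ^ 2 * (n + 1)) &&
          Nat.ble ((G * stepG n L) ^ 133 * 100000 ^ (ps.headD 0)) (271828 ^ (ps.headD 0))) &&
         chkF f (n + 1) (L * stepG n L) (G * stepG n L) ps.tail)

def chkP : ℕ → ℕ → ℕ → Bool
  | 0, _, _ => true
  | f + 1, n, L =>
    (Nat.beq (stepG n L) 1 || Nat.ble (L * stepG n L * 1000 ^ (n + 1)) (2829 ^ (n + 1))) &&
      chkP f (n + 1) (L * stepG n L)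

theorem chkF_ok : chkF 2498 1 1 1 [379, 536, 569, 758, 948, 985, 1073, 1327, 1517, 1707, 2086, 2120, 2146, 2465, 2956, 3034, 3224, 3513, 3604, 4292, 4362, 4742, 5121, 5500, 5880, 6069, 6920, 7018, 7777, 8156, 8584, 8870, 8890, 8915, 9294] = true := by
  decide +kernel

theorem chkP_ok : chkP 699 1 1 = true := by
  decide +kernel

theorem lcm_succ (n : ℕ) :
    Nat.lcmUpto (n + 1) = Nat.lcmUpto n * stepG n (Nat.lcmUpto n) := by
  have h : Nat.lcmUpto (n + 1) = Nat.lcm (Nat.lcmUpto n) (n + 1) := by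
    unfold Nat.lcmUpto
    rw [← Finset.insert_Icc_right_eq_Icc_add_one (by omega), Finset.lcm_insert, Nat.lcm_comm]
    rfl
  rw [h, Nat.lcm, stepG, Nat.mul_div_assoc _ (Nat.gcd_dvd_right _ _)]

theorem stepG_pos (n L : ℕ) : 0 < stepG n L :=
  Nat.div_pos (Nat.le_of_dvd (by omega) (Nat.gcd_dvd_right _ _)) (Nat.gcd_pos_of_pos_right _ (by omega))

theorem psi_succ (n : ℕ) : psi ((n + 1 : ℕ) : ℝ) = psi n + ArithmeticFunction.vonMangoldt (n + 1) := by
  unfold psi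
  rw [Nat.floor_natCast, Nat.floor_natCast, Finset.sum_Ioc_succ_top (by omega)]

theorem lam_succ (n : ℕ) :
    ArithmeticFunction.vonMangoldt (n + 1) = Real.log (stepG n (Nat.lcmUpto n)) := by
  have h := psi_succ n
  rw [psi_eq_log_lcmUpto, psi_eq_log_lcmUpto, lcm_succ, Nat.cast_mul, Real.log_mul] at h
  · linarith
  · exact_mod_cast Nat.lcmUpto_ne_zero n
  · exact_mod_cast (stepG_pos _ _).ne'

noncomputable def D (n : ℕ) : ℝ := psi (n : ℝ) - theta (n : ℝ)

theorem D_succ (n : ℕ) :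
    D (n + 1) = D n + if (n + 1).Prime then 0 else Real.log (stepG n (Nat.lcmUpto n)) := by
  unfold D
  rw [psi_sub_theta_eq_sum_not_prime, psi_sub_theta_eq_sum_not_prime, Nat.floor_natCast,
    Nat.floor_natCast, Finset.sum_filter, Finset.sum_filter, Finset.sum_Ioc_succ_top (by omega),
    ← lam_succ]
  by_cases h : (n + 1).Prime <;> simp [h]

theorem prime_of_step (n : ℕ) (hn : 1 ≤ n) (h : stepG n (Nat.lcmUpto n) = n + 1) : (n + 1).Prime := by
  have h1 := lam_succ n
  rw [h, ArithmeticFunction.vonMangoldt_apply] at h1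
  have hl : 0 < Real.log ((n + 1 : ℕ) : ℝ) := Real.log_pos (by exact_mod_cast (by omega))
  split_ifs at h1 with hp
  · have := Real.log_injOn_pos (by simp [Nat.minFac_pos]) (by simp; positivity) h1
    have h2 : (n + 1).minFac = n + 1 := by exact_mod_cast this
    rw [← h2]; exact Nat.minFac_prime (by omega)
  · linarith

theorem log_le_of_pow (G p q : ℕ) (hq : 0 < q) (hG : 0 < G) (h : G ^ q * 100000 ^ p ≤ 271828 ^ p) :
    Real.log G ≤ p / q := by
  have h1 : ((G : ℝ)) ^ q * 100000 ^ p ≤ 271828 ^ p := by exact_mod_cast h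
  have he : (271828 : ℝ) / 100000 ≤ Real.exp 1 := by
    have := Real.exp_one_gt_d9; norm_num at *; linarith
  have h2 : (G : ℝ) ^ q ≤ Real.exp p := by
    calc (G : ℝ) ^ q ≤ (271828 / 100000) ^ p := by
          rw [div_pow, le_div_iff₀ (by positivity)]; exact h1
      _ ≤ (Real.exp 1) ^ p := by gcongr
      _ = Real.exp p := by rw [← Real.exp_nat_mul, mul_one]
  have h3 := Real.log_le_log (by positivity) h2
  rw [Real.log_pow, Real.log_exp] at h3
  rw [le_div_iff₀ (by exact_mod_cast hq)]; linarith

theorem chkF_sound : ∀ (f n G : ℕ) (ps : List ℕ), 1 ≤ n → 0 < G → D n ≤ Real.log G →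
    Real.log G ≤ 1.4262 * √(n : ℝ) → chkF f n (Nat.lcmUpto n) G ps = true →
    ∀ m, n ≤ m → m ≤ n + f → D m ≤ 1.4262 * √(m : ℝ) := by
  intro f
  induction f with
  | zero =>
    intro n G ps hn hG h1 h2 _ m hm hm'
    have : m = n := by omega
    subst this; linarith
  | succ f ih =>
    intro n G ps hn hG h1 h2 h m hm hm'
    rcases Nat.eq_or_lt_of_le hm with rfl | hlt
    · linarith
    have hD := D_succ n
    have hmono : √(n : ℝ) ≤ √((n + 1 : ℕ) : ℝ) := Real.sqrt_le_sqrt (by push_cast; linarith)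
    rw [chkF, ← lcm_succ] at h
    have hgp := stepG_pos n (Nat.lcmUpto n)
    by_cases hc : (Nat.beq (stepG n (Nat.lcmUpto n)) 1 || Nat.beq (stepG n (Nat.lcmUpto n)) (n + 1)) = true
    · rw [hc, cond_true] at h
      refine ih (n + 1) G ps (by omega) hG ?_ (by linarith) h m hlt (by omega)
      rw [Bool.or_eq_true, Nat.beq_eq, Nat.beq_eq] at hc
      rcases hc with hc | hc
      · rw [hc] at hD; simp at hD; linarith
      · rw [if_pos (prime_of_step n hn hc)] at hD; linarith
    · rw [Bool.not_eq_true] at hc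
      rw [hc, cond_false] at h
      simp only [Bool.and_eq_true] at h
      generalize ps.headD 0 = p at h
      obtain ⟨⟨ha, hb⟩, h⟩ := h
      have ha := Nat.le_of_ble_eq_true ha
      have hb := Nat.le_of_ble_eq_true hb
      have hG' : 0 < G * stepG n (Nat.lcmUpto n) := Nat.mul_pos hG hgp
      refine ih (n + 1) _ ps.tail (by omega) hG' ?_ ?_ h m hlt (by omega)
      · rw [Nat.cast_mul, Real.log_mul (by positivity) (by positivity), hD]
        have : 0 ≤ Real.log (stepG n (Nat.lcmUpto n)) := Real.log_natCast_nonneg _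
        split_ifs <;> linarith
      · have h3 := log_le_of_pow _ p 133 (by norm_num) hG' hb
        refine h3.trans ?_
        have ha' : (p : ℝ) * p * 10 ^ 8 ≤ 133 ^ 2 * 14262 ^ 2 * ((n + 1 : ℕ) : ℝ) := by
          exact_mod_cast ha
        rw [div_le_iff₀ (by norm_num)]
        refine le_of_pow_le_pow_left₀ (n := 2) (by norm_num) (by positivity) ?_
        rw [mul_pow, mul_pow, Real.sq_sqrt (by positivity)]
        push_cast at ha' ⊢
        nlinarith

theorem D_small (m : ℕ) (h1 : 1 ≤ m) (h2 : m ≤ 2499) : D m ≤ 1.4262 * √(m : ℝ) := by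
  have hl : Nat.lcmUpto 1 = 1 := by simp [Nat.lcmUpto]
  have hd : D 1 = 0 := by simp [D]
  refine chkF_sound 2498 1 1 [379, 536, 569, 758, 948, 985, 1073, 1327, 1517, 1707, 2086, 2120, 2146, 2465, 2956, 3034, 3224, 3513, 3604, 4292, 4362, 4742, 5121, 5500, 5880, 6069, 6920, 7018, 7777, 8156, 8584, 8870, 8890, 8915, 9294] le_rfl one_pos ?_ ?_ ?_ m h1 (by omega)
  · simp [hd]
  · norm_num
  · rw [hl]; exact chkF_ok

theorem chkP_sound : ∀ (f n : ℕ), psi n ≤ 1.04 * n → chkP f n (Nat.lcmUpto n) = true →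
    ∀ m, n ≤ m → m ≤ n + f → psi (m : ℝ) ≤ 1.04 * m := by
  intro f
  induction f with
  | zero =>
    intro n h1 _ m hm hm'
    have : m = n := by omega
    subst this; linarith
  | succ f ih =>
    intro n h1 h m hm hm'
    rcases Nat.eq_or_lt_of_le hm with rfl | hlt
    · linarith
    rw [chkP, ← lcm_succ, Bool.and_eq_true, Bool.or_eq_true, Nat.beq_eq] at h
    obtain ⟨h2, h⟩ := h
    refine ih (n + 1) ?_ h m hlt (by omega)
    rcases h2 with h2 | h2
    · rw [psi_succ, lam_succ, h2]; push_cast; simp; linarith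
    · have h2 := Nat.le_of_ble_eq_true h2
      rw [psi_eq_log_lcmUpto]
      have h3 : (Nat.lcmUpto (n + 1) : ℝ) ≤ (2829 / 1000) ^ (n + 1) := by
        rw [div_pow, le_div_iff₀ (by positivity)]; exact_mod_cast h2
      have hpos : (0 : ℝ) < Nat.lcmUpto (n + 1) := by exact_mod_cast Nat.lcmUpto_pos _
      have h4 := Real.log_le_log hpos h3
      rw [Real.log_pow] at h4
      have h5 := log_le_of_pow 2829 (104 + 691) 100
      have h6 : Real.log (2829 / 1000) ≤ 1.04 := by
        rw [Real.log_le_iff_le_exp (by norm_num)]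
        have he : (271828 : ℝ) / 100000 ≤ Real.exp 1 := by
          have := Real.exp_one_gt_d9; norm_num at *; linarith
        apply le_of_pow_le_pow_left₀ (n := 25) (by norm_num) (by positivity)
        rw [← Real.exp_nat_mul]
        calc ((2829 : ℝ) / 1000) ^ 25 ≤ (271828 / 100000) ^ 26 := by norm_num
          _ ≤ Real.exp 1 ^ 26 := by gcongr
          _ = _ := by rw [← Real.exp_nat_mul]; norm_num
      have : (0 : ℝ) ≤ ((n + 1 : ℕ) : ℝ) := by positivity
      nlinarith

theorem psi_small (m : ℕ) (h2 : m ≤ 700) : psi (m : ℝ) ≤ 1.04 * m := by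
  rcases Nat.eq_zero_or_pos m with rfl | h1
  · simp
  have hl : Nat.lcmUpto 1 = 1 := by simp [Nat.lcmUpto]
  refine chkP_sound 699 1 ?_ ?_ m h1 (by omega)
  · norm_num
  · rw [hl]; exact chkP_ok

theorem log_fac (M : ℕ) (N : ℕ) (h : N ≤ M) : Real.log (N.factorial : ℝ) =
    ∑ d ∈ Finset.Ioc 0 M, ArithmeticFunction.vonMangoldt d * ((N / d : ℕ) : ℝ) := by
  induction N with
  | zero => simp
  | succ N ih =>
    rw [Nat.factorial_succ, Nat.cast_mul, Real.log_mul (by positivity) (by positivity),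
      ih (by omega), ← ArithmeticFunction.vonMangoldt_sum]
    have : (N + 1).divisors = (Finset.Ioc 0 M).filter (fun d => d ∣ N + 1) := by
      ext d
      simp only [Nat.mem_divisors, Finset.mem_filter, Finset.mem_Ioc]
      constructor
      · rintro ⟨h1, _⟩
        exact ⟨⟨Nat.pos_of_dvd_of_pos h1 (by omega), (Nat.le_of_dvd (by omega) h1).trans h⟩, h1⟩
      · rintro ⟨_, h1⟩; exact ⟨h1, by omega⟩
    rw [this, Finset.sum_filter, ← Finset.sum_add_distrib]
    refine Finset.sum_congr rfl fun d _ => ?_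
    rw [Nat.succ_div]
    split_ifs <;> push_cast <;> ring

theorem fac_bound (n : ℕ) : (6 * n).factorial ≤
    432 ^ n * ((3 * n).factorial * (2 * n).factorial * n.factorial) := by
  induction n with
  | zero => simp
  | succ n ih =>
    have e6 : (6 * (n + 1)).factorial = (6*n+6)*((6*n+5)*((6*n+4)*((6*n+3)*((6*n+2)*((6*n+1)*(6*n).factorial))))) := by
      rw [show 6 * (n + 1) = 6*n+1+1+1+1+1+1 by ring]; simp only [Nat.factorial_succ]
    have e3 : (3 * (n + 1)).factorial = (3*n+3)*((3*n+2)*((3*n+1)*(3*n).factorial)) := by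
      rw [show 3 * (n + 1) = 3*n+1+1+1 by ring]; simp only [Nat.factorial_succ]
    have e2 : (2 * (n + 1)).factorial = (2*n+2)*((2*n+1)*(2*n).factorial) := by
      rw [show 2 * (n + 1) = 2*n+1+1 by ring]; simp only [Nat.factorial_succ]
    rw [e6, e3, e2, Nat.factorial_succ n]
    have key : (6*n+5)*(6*n+1) ≤ 36*(n+1)*(n+1) := by nlinarith
    calc _ = (24 * ((3*n+3)*(3*n+2)*(3*n+1)*(2*n+1))) * (((6*n+5)*(6*n+1)) * (6*n).factorial) := by ring
      _ ≤ (24 * ((3*n+3)*(3*n+2)*(3*n+1)*(2*n+1))) * ((36*(n+1)*(n+1)) * (432 ^ n * ((3 * n).factorial * (2 * n).factorial * n.factorial))) := by gcongr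
      _ = _ := by ring

theorem psi_six (n : ℕ) : psi ((6 * n : ℕ) : ℝ) ≤ psi (n : ℝ) + n * Real.log 432 := by
  have h1 : Real.log ((6 * n).factorial : ℝ) ≤ n * Real.log 432 + (Real.log ((3*n).factorial : ℝ) +
      Real.log ((2*n).factorial : ℝ) + Real.log (n.factorial : ℝ)) := by
    have h := fac_bound n
    have h' : ((6 * n).factorial : ℝ) ≤
      432 ^ n * (((3 * n).factorial : ℝ) * ((2 * n).factorial : ℝ) * (n.factorial : ℝ)) := by exact_mod_cast h
    have := Real.log_le_log (by positivity) h'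
    rwa [Real.log_mul (by positivity) (by positivity), Real.log_mul (by positivity) (by positivity),
      Real.log_mul (by positivity) (by positivity), Real.log_pow] at this
  rw [log_fac (6*n) (6*n) le_rfl, log_fac (6*n) (3*n) (by omega), log_fac (6*n) (2*n) (by omega),
    log_fac (6*n) n (by omega)] at h1
  have h2 : psi (n : ℝ) = ∑ d ∈ Finset.Ioc 0 (6 * n), if d ≤ n then ArithmeticFunction.vonMangoldt d else 0 := by
    unfold psi
    rw [Nat.floor_natCast, ← Finset.sum_filter]
    refine Finset.sum_congr ?_ fun _ _ => rfl
    ext d; simp only [Finset.mem_filter, Finset.mem_Ioc]; omega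
  have h3 : psi ((6 * n : ℕ) : ℝ) = ∑ d ∈ Finset.Ioc 0 (6 * n), ArithmeticFunction.vonMangoldt d := by
    unfold psi
    rw [Nat.floor_natCast]
  suffices h : psi ((6 * n : ℕ) : ℝ) + (∑ d ∈ Finset.Ioc 0 (6*n), ArithmeticFunction.vonMangoldt d * ((3 * n / d : ℕ) : ℝ) +
      ∑ d ∈ Finset.Ioc 0 (6*n), ArithmeticFunction.vonMangoldt d * ((2 * n / d : ℕ) : ℝ) +
      ∑ d ∈ Finset.Ioc 0 (6*n), ArithmeticFunction.vonMangoldt d * ((n / d : ℕ) : ℝ)) ≤ psi (n : ℝ) +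
      ∑ d ∈ Finset.Ioc 0 (6*n), ArithmeticFunction.vonMangoldt d * ((6 * n / d : ℕ) : ℝ) by linarith
  rw [h2, h3, ← Finset.sum_add_distrib, ← Finset.sum_add_distrib, ← Finset.sum_add_distrib, ← Finset.sum_add_distrib]
  refine Finset.sum_le_sum fun d hd => ?_
  rw [Finset.mem_Ioc] at hd
  have hL : 0 ≤ ArithmeticFunction.vonMangoldt d := ArithmeticFunction.vonMangoldt_nonneg
  have a3 := Nat.div_mul_le_self (3 * n) d
  have a2 := Nat.div_mul_le_self (2 * n) d
  have a1 := Nat.div_mul_le_self n d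
  by_cases hdn : d ≤ n
  · rw [if_pos hdn]
    have : 3 * n / d + 2 * n / d + n / d ≤ 6 * n / d := by
      rw [Nat.le_div_iff_mul_le hd.1]; linarith
    have : ((3 * n / d : ℕ) : ℝ) + ((2 * n / d : ℕ) : ℝ) + ((n / d : ℕ) : ℝ) ≤ ((6 * n / d : ℕ) : ℝ) := by
      exact_mod_cast this
    nlinarith
  · rw [if_neg hdn]
    have : 1 + 3 * n / d + 2 * n / d + n / d ≤ 6 * n / d := by
      have z1 : n / d = 0 := Nat.div_eq_of_lt (by omega)
      have z2 : 2 * n / d < 2 := Nat.div_lt_of_lt_mul (by omega)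
      have z3 : 3 * n / d < 3 := Nat.div_lt_of_lt_mul (by omega)
      rw [z1, Nat.le_div_iff_mul_le hd.1]
      generalize 3 * n / d = u at *
      generalize 2 * n / d = v at *
      interval_cases u <;> interval_cases v <;> omega
    have : 1 + ((3 * n / d : ℕ) : ℝ) + ((2 * n / d : ℕ) : ℝ) + ((n / d : ℕ) : ℝ) ≤ ((6 * n / d : ℕ) : ℝ) := by
      exact_mod_cast this
    nlinarith

theorem log432 : Real.log 432 ≤ 6.08 := by
  have := log_le_of_pow 432 152 25 (by norm_num) (by norm_num) (by norm_num)
  norm_num at *; linarith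

theorem psi_all (m : ℕ) : psi (m : ℝ) ≤ 1.25 * m := by
  induction m using Nat.strong_induction_on with
  | _ m ih =>
    by_cases hm : m ≤ 700
    · have := psi_small m hm
      have : (0 : ℝ) ≤ m := by positivity
      linarith
    · have h1 := psi_six ((m + 5) / 6)
      have h2 := ih ((m + 5) / 6) (by omega)
      have h3 : psi (m : ℝ) ≤ psi ((6 * ((m + 5) / 6) : ℕ) : ℝ) := psi_mono (by exact_mod_cast (by omega))
      have h4 : (((m + 5) / 6 : ℕ) : ℝ) * 6 ≤ m + 5 := by exact_mod_cast (by omega)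
      have h5 : (700 : ℝ) < m := by exact_mod_cast (by omega)
      have h6 : (0 : ℝ) ≤ (((m + 5) / 6 : ℕ) : ℝ) := by positivity
      have := log432
      nlinarith

theorem psi_all_real (z : ℝ) (hz : 0 ≤ z) : psi z ≤ 1.25 * z := by
  rw [psi_eq_psi_coe_floor]
  have := psi_all ⌊z⌋₊
  have := Nat.floor_le hz
  linarith

theorem psi_small_real (z : ℝ) (hz : 0 ≤ z) (h : z ≤ 700) : psi z ≤ 1.04 * z := by
  rw [psi_eq_psi_coe_floor]
  have := psi_small ⌊z⌋₊ (Nat.floor_le_of_le (by exact_mod_cast h))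
  have := Nat.floor_le hz
  linarith

theorem main_bound (x : ℝ) (hx : 2 ≤ x) : psi x - theta x ≤ 1.4262 * √x := by
  by_cases hs : x < 2500
  · rw [psi_eq_psi_coe_floor, theta_eq_theta_coe_floor]
    have h1 : ⌊x⌋₊ < 2500 := (Nat.floor_lt (by linarith)).2 (by exact_mod_cast hs)
    have h2 : 1 ≤ ⌊x⌋₊ := Nat.le_floor (by norm_num; linarith)
    have h3 := D_small _ h2 (by omega)
    have h4 : √((⌊x⌋₊ : ℕ) : ℝ) ≤ √x := Real.sqrt_le_sqrt (Nat.floor_le (by linarith))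
    unfold D at h3
    linarith
  have hx0 : (0 : ℝ) ≤ x := by linarith
  have h := psi_sub_theta_le_psi_add_psi_add_psi x
  obtain ⟨t, ht0, ht⟩ : ∃ t : ℝ, 0 ≤ t ∧ x = t ^ 30 :=
    ⟨x ^ ((30 : ℕ) : ℝ)⁻¹, by positivity, (Real.rpow_inv_natCast_pow hx0 (by norm_num)).symm⟩
  have e2 : x ^ (2 : ℝ)⁻¹ = t ^ 15 := by
    rw [ht, show t ^ 30 = (t ^ 15) ^ 2 by ring]
    exact_mod_cast Real.pow_rpow_inv_natCast (n := 2) (by positivity) (by norm_num)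
  have e3 : x ^ (3 : ℝ)⁻¹ = t ^ 10 := by
    rw [ht, show t ^ 30 = (t ^ 10) ^ 3 by ring]
    exact_mod_cast Real.pow_rpow_inv_natCast (n := 3) (by positivity) (by norm_num)
  have e5 : x ^ (5 : ℝ)⁻¹ = t ^ 6 := by
    rw [ht, show t ^ 30 = (t ^ 6) ^ 5 by ring]
    exact_mod_cast Real.pow_rpow_inv_natCast (n := 5) (by positivity) (by norm_num)
  have es : √x = t ^ 15 := by
    rw [ht, show t ^ 30 = (t ^ 15) ^ 2 by ring, Real.sqrt_sq (by positivity)]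
  rw [e2, e3, e5] at h
  rw [es]
  have h50 : 50 ≤ t ^ 15 := by
    rw [← es]; apply Real.le_sqrt_of_sq_le; linarith
  have ht1 : 1.297 ≤ t := by
    by_contra hc
    have : t ^ 15 ≤ 1.297 ^ 15 := by gcongr; linarith
    norm_num at this; linarith
  have p10 : 0 ≤ t ^ 10 := by positivity
  have p6 : 0 ≤ t ^ 6 := by positivity
  by_cases hb : t ^ 15 ≤ 700
  · have q15 := psi_small_real (t ^ 15) (by positivity) hb
    have l10 : t ^ 10 ≤ t ^ 15 := pow_le_pow_right₀ (by linarith) (by norm_num)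
    have l6 : t ^ 6 ≤ t ^ 15 := pow_le_pow_right₀ (by linarith) (by norm_num)
    have q10 := psi_small_real (t ^ 10) (by positivity) (by linarith)
    have q6 := psi_small_real (t ^ 6) (by positivity) (by linarith)
    have a5 : 3.67 ≤ t ^ 5 := le_trans (by norm_num) (pow_le_pow_left₀ (by norm_num) ht1 5)
    have a9 : 10.38 ≤ t ^ 9 := le_trans (by norm_num) (pow_le_pow_left₀ (by norm_num) ht1 9)
    have b10 : 3.67 * t ^ 10 ≤ t ^ 15 := by
      rw [show t ^ 15 = t ^ 5 * t ^ 10 by ring]; gcongr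
    have b6 : 10.38 * t ^ 6 ≤ t ^ 15 := by
      rw [show t ^ 15 = t ^ 9 * t ^ 6 by ring]; gcongr
    linarith
  · have ht2 : 1.547 ≤ t := by
      by_contra hc
      have : t ^ 15 ≤ 1.547 ^ 15 := by gcongr; linarith
      norm_num at this; linarith
    have q15 := psi_all_real (t ^ 15) (by positivity)
    have q10 := psi_all_real (t ^ 10) (by positivity)
    have q6 := psi_all_real (t ^ 6) (by positivity)
    have a5 : 8.85 ≤ t ^ 5 := le_trans (by norm_num) (pow_le_pow_left₀ (by norm_num) ht2 5)
    have a9 : 50 ≤ t ^ 9 := le_trans (by norm_num) (pow_le_pow_left₀ (by norm_num) ht2 9)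
    have b10 : 8.85 * t ^ 10 ≤ t ^ 15 := by
      rw [show t ^ 15 = t ^ 5 * t ^ 10 by ring]; gcongr
    have b6 : 50 * t ^ 6 ≤ t ^ 15 := by
      rw [show t ^ 15 = t ^ 9 * t ^ 6 by ring]; gcongr
    linarith

theorem sum_le (x : ℝ) (hx : 2 ≤ x) :
    (∑ p ∈ Finset.range (⌊x⌋₊ + 1), ∑ r ∈ Finset.range (⌊x⌋₊ + 1),
          if p.Prime ∧ 2 ≤ r ∧ ((p ^ r : ℕ) : ℝ) ≤ x then Real.log p else 0) ≤ psi x - theta x := by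
  rw [psi_eq_psi_coe_floor, theta_eq_theta_coe_floor, psi_eq_sum_mul_log_prime,
    theta_eq_sum_primesLE_log, ← Finset.sum_sub_distrib]
  have hP : Nat.primesLE ⌊x⌋₊ = (Finset.range (⌊x⌋₊ + 1)).filter Nat.Prime := by
    ext p; simp [Nat.mem_primesLE, Nat.lt_succ_iff]
  rw [hP, Finset.sum_filter]
  refine Finset.sum_le_sum fun p hp => ?_
  rw [Finset.mem_range, Nat.lt_succ_iff] at hp
  by_cases hpp : p.Prime
  · rw [if_pos hpp, ← Finset.sum_filter, Finset.sum_const, nsmul_eq_mul]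
    have hl : 0 ≤ Real.log p := Real.log_natCast_nonneg p
    have h1 : 1 ≤ Nat.log p ⌊x⌋₊ := Nat.log_pos hpp.one_lt hp
    have hc : ((Finset.range (⌊x⌋₊ + 1)).filter
        (fun r => p.Prime ∧ 2 ≤ r ∧ ((p ^ r : ℕ) : ℝ) ≤ x)).card + 1 ≤ Nat.log p ⌊x⌋₊ := by
      have hsub : ((Finset.range (⌊x⌋₊ + 1)).filter
        (fun r => p.Prime ∧ 2 ≤ r ∧ ((p ^ r : ℕ) : ℝ) ≤ x)) ⊆ Finset.Icc 2 (Nat.log p ⌊x⌋₊) := by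
        intro r hr
        rw [Finset.mem_filter] at hr
        rw [Finset.mem_Icc]
        exact ⟨hr.2.2.1, Nat.le_log_of_pow_le hpp.one_lt (Nat.le_floor hr.2.2.2)⟩
      have := Finset.card_le_card hsub
      rw [Nat.card_Icc] at this
      omega
    have hc' : (((Finset.range (⌊x⌋₊ + 1)).filter
        (fun r => p.Prime ∧ 2 ≤ r ∧ ((p ^ r : ℕ) : ℝ) ≤ x)).card : ℝ) + 1 ≤ Nat.log p ⌊x⌋₊ := by
      exact_mod_cast hc
    nlinarith
  · simp [hpp]

end PsiTheta

theorem psi_sub_theta_bound (x : ℝ) (hx : 2 ≤ x) :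
    0 ≤ (∑ p ∈ Finset.range (⌊x⌋₊ + 1), ∑ r ∈ Finset.range (⌊x⌋₊ + 1),
          if p.Prime ∧ 2 ≤ r ∧ ((p ^ r : ℕ) : ℝ) ≤ x then Real.log p else 0) ∧
    (∑ p ∈ Finset.range (⌊x⌋₊ + 1), ∑ r ∈ Finset.range (⌊x⌋₊ + 1),
          if p.Prime ∧ 2 ≤ r ∧ ((p ^ r : ℕ) : ℝ) ≤ x then Real.log p else 0)
        ≤ 1.42620 * Real.sqrt x := by
  constructor
  · refine Finset.sum_nonneg fun p _ => Finset.sum_nonneg fun r _ => ?_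
    split_ifs
    · exact Real.log_natCast_nonneg p
    · exact le_rfl
  · refine (PsiTheta.sum_le x hx).trans ((PsiTheta.main_bound x hx).trans (le_of_eq ?_))
    norm_num
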